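/- arXiv:1011.5883 — 3 statements merged into one kernel-verified Lean document; each statement's English description precedes it below -/
import Mathlib

section
/- For every m ≥ 1, every co-blocker of CGG(2m) is a perfect matching, and all of its edges have odd order. -/
/-- The vertex set of the complete convex geometric graph `CGG(2m)`:
the vertices are labelled cyclically by `0, 1, …, 2m-1`. -/
abbrev Vtx (m : ℕ) := ZMod (2 * m)

/-- The order of an edge `{i,j}` of `CGG(2m)`: `min (|i-j|, 2m - |i-j|)`. -/
def edgeOrder (m : ℕ) : Sym2 (Vtx m) → ℕ :=
  Sym2.lift ⟨fun i j => min (i - j).val (j - i).val, fun i j => min_comm _ _⟩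

/-- The direction of an edge `{i,j}` of `CGG(2m)`: `i + j (mod 2m)`. -/
def edgeDir (m : ℕ) : Sym2 (Vtx m) → Vtx m :=
  Sym2.lift ⟨fun i j => i + j, fun i j => add_comm i j⟩

/-- `x` lies on the open cyclic arc from `a` to `b`, taken counterclockwise. -/
def InArc (m : ℕ) (a b x : Vtx m) : Prop :=
  0 < (x - a).val ∧ (x - a).val < (b - a).val

/-- Two edges of `CGG(2m)` cross: their endpoints interleave in the cyclic order,
i.e. writing them as `{a,b}` and `{c,d}`, exactly one of `c, d` lies on the open
cyclic arc from `a` to `b` taken counterclockwise. -/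
def Crosses (m : ℕ) (e f : Sym2 (Vtx m)) : Prop :=
  ∃ a b c d : Vtx m, e = s(a, b) ∧ f = s(c, d) ∧
    Xor' (InArc m a b c) (InArc m a b d)

/-- Two edges of `CGG(2m)` are neighbors: some endpoint of one differs by `±1`
(mod `2m`) from some endpoint of the other. -/
def Neighbors (m : ℕ) (e f : Sym2 (Vtx m)) : Prop :=
  ∃ x ∈ e, ∃ y ∈ f, x = y + 1 ∨ y = x + 1

/-- `M` is a perfect matching of `CGG(2m)`: a set of pairwise vertex-disjoint
edges covering all `2m` vertices. -/
def IsPM (m : ℕ) (M : Finset (Sym2 (Vtx m))) : Prop :=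
  (∀ e ∈ M, ¬ e.IsDiag) ∧
  (∀ e ∈ M, ∀ f ∈ M, e ≠ f → ∀ x : Vtx m, x ∈ e → x ∉ f) ∧
  (∀ x : Vtx m, ∃ e ∈ M, x ∈ e)

/-- `M` is a simple perfect matching (SPM) of `CGG(2m)`: a perfect matching
no two of whose edges cross. -/
def IsSPM (m : ℕ) (M : Finset (Sym2 (Vtx m))) : Prop :=
  IsPM m M ∧ ∀ e ∈ M, ∀ f ∈ M, e ≠ f → ¬ Crosses m e f

/-- `M` is a semi-simple perfect matching of `CGG(2m)`: a perfect matching all of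
whose edges have odd order, and no two neighboring edges of which cross. -/
def IsSemiSimple (m : ℕ) (M : Finset (Sym2 (Vtx m))) : Prop :=
  IsPM m M ∧ (∀ e ∈ M, Odd (edgeOrder m e)) ∧
  ∀ e ∈ M, ∀ f ∈ M, e ≠ f → Neighbors m e f → ¬ Crosses m e f

/-- `B` is a set of edges of `CGG(2m)` that meets every member of the family `F`,
of minimum cardinality among all sets of edges meeting every member of `F`. -/
def MinTransversal (m : ℕ) (F : Set (Finset (Sym2 (Vtx m))))
    (B : Finset (Sym2 (Vtx m))) : Prop :=
  (∀ e ∈ B, ¬ e.IsDiag) ∧ (∀ M ∈ F, (B ∩ M).Nonempty) ∧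
  ∀ B' : Finset (Sym2 (Vtx m)), (∀ e ∈ B', ¬ e.IsDiag) →
    (∀ M ∈ F, (B' ∩ M).Nonempty) → B.card ≤ B'.card

/-- `B` is a blocker of `CGG(2m)`: a set of edges meeting every SPM, of minimum
cardinality among all sets of edges meeting every SPM. -/
def IsBlocker (m : ℕ) (B : Finset (Sym2 (Vtx m))) : Prop :=
  MinTransversal m {M | IsSPM m M} B

/-- `C` is a co-blocker of `CGG(2m)`: a set of edges meeting every blocker, of
minimum cardinality among all sets of edges meeting every blocker. -/
def IsCoBlocker (m : ℕ) (C : Finset (Sym2 (Vtx m))) : Prop :=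
  MinTransversal m {B | IsBlocker m B} C

/-- Reduction of a vertex label modulo `2`. -/
def vtxParity (m : ℕ) : Vtx m →+* ZMod 2 := ZMod.castHom (dvd_mul_right 2 m) (ZMod 2)

/-- The set of all edges of direction `k`. -/
def parallelClass (m : ℕ) [NeZero m] (k : Vtx m) : Finset (Sym2 (Vtx m)) :=
  Finset.univ.filter fun e => edgeDir m e = k

/-- The set of all edges joining `v` to a vertex of the other parity. -/
def oddStar (m : ℕ) [NeZero m] (v : Vtx m) : Finset (Sym2 (Vtx m)) :=
  (Finset.univ.filter fun w => vtxParity m w = vtxParity m v + 1).image fun w => s(v, w)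

theorem ZMod.two_ne_iff_eq_add_one (a b : ZMod 2) : a ≠ b ↔ a = b + 1 := by
  revert a b; decide

theorem Sym2.card_toFinset_le_two {α : Type*} [DecidableEq α] (e : Sym2 α) :
    e.toFinset.card ≤ 2 := by
  rw [Sym2.card_toFinset]
  split_ifs <;> omega

theorem card_biUnion_toFinset_le {α : Type*} [DecidableEq α] (C : Finset (Sym2 α)) :
    (C.biUnion Sym2.toFinset).card ≤ 2 * C.card := by
  exact (Finset.card_biUnion_le_card_mul _ _ 2 fun e _ => e.card_toFinset_le_two).trans_eq
    (mul_comm _ _)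

section

variable {m : ℕ} [NeZero m]

theorem vtxParity_eq_val (x : Vtx m) : vtxParity m x = (x.val : ZMod 2) := by
  simp [vtxParity, ZMod.natCast_val]

theorem odd_edgeOrder_of_vtxParity_ne {a b : Vtx m} (h : vtxParity m a ≠ vtxParity m b) :
    Odd (edgeOrder m s(a, b)) := by
  have key : ∀ x y : Vtx m, vtxParity m x ≠ vtxParity m y → Odd (x - y).val := by
    intro x y hxy
    rw [← ZMod.natCast_eq_one_iff_odd, ← vtxParity_eq_val, map_sub,
      (ZMod.two_ne_iff_eq_add_one _ _).1 hxy, add_sub_cancel_left]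
  change Odd (min (a - b).val (b - a).val)
  rcases min_choice (a - b).val (b - a).val with h' | h' <;> rw [h']
  · exact key a b h
  · exact key b a h.symm

theorem card_filter_vtxParity (c : ZMod 2) :
    (Finset.univ.filter fun x : Vtx m => vtxParity m x = c).card = m := by
  have h1 : (Finset.univ.filter fun x : Vtx m => vtxParity m x = c).card =
      (Finset.univ.filter fun x : Vtx m => ¬ vtxParity m x = c).card := by
    refine Finset.card_equiv (Equiv.addRight 1) fun x => ?_
    simp only [Finset.mem_filter, Finset.mem_univ, true_and, Equiv.coe_addRight, map_add, map_one]
    generalize vtxParity m x = y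
    revert y c; decide
  have h2 := Finset.card_filter_add_card_filter_not (s := (Finset.univ : Finset (Vtx m)))
    (fun x => vtxParity m x = c)
  rw [Finset.card_univ, ZMod.card] at h2
  omega

theorem IsPM.two_mul_card {M : Finset (Sym2 (Vtx m))} (h : IsPM m M) : 2 * M.card = 2 * m := by
  have h1 : M.biUnion Sym2.toFinset = Finset.univ := by
    ext x
    simpa using h.2.2 x
  have h2 : (M.biUnion Sym2.toFinset).card = ∑ e ∈ M, e.toFinset.card := by
    refine Finset.card_biUnion fun e he f hf hne => ?_
    rw [Function.onFun, Finset.disjoint_left]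
    simpa using h.2.1 e he f hf hne
  rw [h1, Finset.card_univ, ZMod.card,
    Finset.sum_congr rfl fun e he => Sym2.card_toFinset_of_not_isDiag e (h.1 e he)] at h2
  simp at h2
  omega

theorem val_sub_of_lt {n : ℕ} [NeZero n] {x y : ZMod n} (h : x.val < y.val) :
    (x - y).val = n + x.val - y.val := by
  have h0 : (y - x).val = y.val - x.val := ZMod.val_sub h.le
  have : NeZero (y - x) := ⟨fun h' => by rw [h', ZMod.val_zero] at h0; omega⟩
  rw [← neg_sub, ZMod.val_neg_of_ne_zero, h0]
  have := y.val_lt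
  omega

theorem isSPM_parallelClass {k : Vtx m} (hk : vtxParity m k = 1) :
    IsSPM m (parallelClass m k) := by
  have hmem : ∀ a b : Vtx m, s(a, b) ∈ parallelClass m k ↔ a + b = k := by
    intro a b
    rw [parallelClass, Finset.mem_filter, and_iff_right (Finset.mem_univ _)]
    rfl
  refine ⟨⟨?_, ?_, ?_⟩, ?_⟩
  · intro e
    induction e with | _ a b
    rw [hmem, Sym2.mk_isDiag_iff]
    rintro rfl rfl
    rw [map_add, CharTwo.add_self_eq_zero] at hk
    exact zero_ne_one hk
  · intro e he f hf hne x hx hx'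
    obtain ⟨y, rfl⟩ := hx
    obtain ⟨z, rfl⟩ := hx'
    rw [hmem] at he hf
    exact hne (by rw [add_left_cancel (he.trans hf.symm)])
  · intro x
    exact ⟨s(x, k - x), (hmem _ _).2 (by ring), Sym2.mem_mk_left _ _⟩
  · rintro e he f hf hne ⟨a, b, c, d, rfl, rfl, hx⟩
    rw [hmem] at he hf
    have hd : d - a = (b - a) - (c - a) := by linear_combination hf - he
    have hca : c ≠ a := by
      rintro rfl
      exact hne (by rw [add_left_cancel (he.trans hf.symm)])
    have hcb : c ≠ b := by
      rintro rfl
      have : d = a := by linear_combination hf - he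
      exact hne (by rw [this, Sym2.eq_swap])
    have h0 : (c - a).val ≠ 0 := by
      rw [Ne, ZMod.val_eq_zero, sub_eq_zero]; exact hca
    have h1 : (c - a).val ≠ (b - a).val := fun h =>
      hcb (sub_left_injective (ZMod.val_injective _ h))
    have h2 := (c - a).val_lt
    unfold InArc at hx
    rw [hd] at hx
    rcases lt_or_gt_of_ne h1 with h | h
    · rw [ZMod.val_sub h.le] at hx
      rcases hx with hx | hx <;> omega
    · rw [val_sub_of_lt h] at hx
      rcases hx with hx | hx <;> omega

theorem card_filter_inArc (a b : Vtx m) [DecidablePred (InArc m a b)] :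
    (Finset.univ.filter (InArc m a b)).card = (b - a).val - 1 := by
  rw [← Nat.sub_zero (b - a).val, ← Nat.card_Ioo]
  refine Finset.card_bij (fun x _ => (x - a).val) ?_ ?_ ?_
  · intro x hx
    simpa [InArc] using hx
  · intro x _ y _ h
    exact sub_left_injective (ZMod.val_injective _ h)
  · intro t ht
    rw [Finset.mem_Ioo] at ht
    have hv : ((t : Vtx m)).val = t := ZMod.val_cast_of_lt (ht.2.trans (ZMod.val_lt _))
    exact ⟨a + t, by simpa [InArc, hv] using ht, by simp [hv]⟩

theorem IsSPM.vtxParity_ne {M : Finset (Sym2 (Vtx m))} (h : IsSPM m M) {a b : Vtx m}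
    (hab : s(a, b) ∈ M) : vtxParity m a ≠ vtxParity m b := by
  classical
  obtain ⟨⟨hdiag, hdisj, hcov⟩, hcross⟩ := h
  have huniq : ∀ {x y z : Vtx m}, s(x, y) ∈ M → s(x, z) ∈ M → y = z := by
    intro x y z hy hz
    by_contra hne
    exact hdisj _ hy _ hz (fun h => hne (Sym2.congr_right.1 h)) x (Sym2.mem_mk_left _ _)
      (Sym2.mem_mk_left _ _)
  have hpartner : ∀ x : Vtx m, ∃ y, s(x, y) ∈ M := by
    intro x
    obtain ⟨e, he, y, rfl⟩ := hcov x
    exact ⟨y, he⟩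
  choose g hg using hpartner
  have hmaps : ∀ x, InArc m a b x → InArc m a b (g x) := by
    intro x hx
    by_contra hgx
    refine hcross _ hab _ (hg x) ?_ ⟨a, b, x, g x, rfl, rfl, Or.inl ⟨hx, hgx⟩⟩
    intro heq
    have hmem : x ∈ s(a, b) := heq ▸ Sym2.mem_mk_left _ _
    rcases Sym2.mem_iff.1 hmem with rfl | rfl
    · simp [InArc] at hx
    · exact lt_irrefl _ hx.2
  have hsum : ∑ x ∈ Finset.univ.filter (InArc m a b), (1 : ZMod 2) = 0 := by
    refine Finset.sum_involution (fun x _ => g x) (fun _ _ => by decide) ?_ ?_ ?_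
    · intro x _ _ hx
      exact hdiag _ (hg x) (Sym2.mk_isDiag_iff.2 hx.symm)
    · intro x hx
      simpa using hmaps x (by simpa using hx)
    · intro x _
      exact huniq (hg (g x)) (Sym2.eq_swap ▸ hg x)
  rw [Finset.sum_const, nsmul_one, card_filter_inArc] at hsum
  have hne : (b - a).val ≠ 0 := by
    rw [Ne, ZMod.val_eq_zero, sub_eq_zero]
    exact fun h => hdiag _ hab (Sym2.mk_isDiag_iff.2 h.symm)
  rw [Nat.cast_sub (by omega), ← vtxParity_eq_val, map_sub, Nat.cast_one] at hsum
  rw [ne_comm, ZMod.two_ne_iff_eq_add_one]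
  linear_combination hsum

theorem isBlocker_oddStar (v : Vtx m) : IsBlocker m (oddStar m v) := by
  refine ⟨?_, ?_, ?_⟩
  · intro e he
    simp only [oddStar, Finset.mem_image, Finset.mem_filter, Finset.mem_univ, true_and] at he
    obtain ⟨w, hw, rfl⟩ := he
    rw [Sym2.mk_isDiag_iff]
    rintro rfl
    exact (ZMod.two_ne_iff_eq_add_one _ _).2 hw rfl
  · intro M hM
    obtain ⟨e, he, w, rfl⟩ := hM.1.2.2 v
    refine ⟨s(v, w), Finset.mem_inter.2 ⟨?_, he⟩⟩
    exact Finset.mem_image_of_mem _ (Finset.mem_filter.2 ⟨Finset.mem_univ _,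
      (ZMod.two_ne_iff_eq_add_one _ _).1 (hM.vtxParity_ne he).symm⟩)
  · intro B' _ hB'
    calc (oddStar m v).card ≤ m := Finset.card_image_le.trans (card_filter_vtxParity _).le
      _ = (Finset.univ.filter fun k : Vtx m => vtxParity m k = 1).card :=
        (card_filter_vtxParity 1).symm
      _ ≤ (B'.image (edgeDir m)).card := by
        refine Finset.card_le_card fun k hk => ?_
        obtain ⟨e, he⟩ := hB' _ (isSPM_parallelClass (Finset.mem_filter.1 hk).2)
        rw [Finset.mem_inter] at he
        exact Finset.mem_image.2 ⟨e, he.1, (Finset.mem_filter.1 he.2).2⟩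
      _ ≤ B'.card := Finset.card_image_le

theorem IsCoBlocker.card_le {C : Finset (Sym2 (Vtx m))} (hC : IsCoBlocker m C) : C.card ≤ m := by
  have hM : IsSPM m (parallelClass m 1) := isSPM_parallelClass (map_one _)
  have h := hC.2.2 _ hM.1.1 fun B hB => by
    rw [Finset.inter_comm]
    exact hB.2.1 _ hM
  have := hM.1.two_mul_card
  omega

theorem le_card_of_forall_exists_mem {C : Finset (Sym2 (Vtx m))}
    (h : ∀ x : Vtx m, ∃ e ∈ C, x ∈ e) : m ≤ C.card := by
  have h1 : C.biUnion Sym2.toFinset = Finset.univ := by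
    ext x
    simpa using h x
  have h2 := card_biUnion_toFinset_le C
  rw [h1, Finset.card_univ, ZMod.card] at h2
  omega

theorem isPM_of_card_le {C : Finset (Sym2 (Vtx m))} (hdiag : ∀ e ∈ C, ¬ e.IsDiag)
    (hcov : ∀ x : Vtx m, ∃ e ∈ C, x ∈ e) (hcard : C.card ≤ m) : IsPM m C := by
  refine ⟨hdiag, fun e he f hf hne x hxe hxf => ?_, hcov⟩
  have hsub : (Finset.univ : Finset (Vtx m)) ⊆
      e.toFinset.erase x ∪ (C.erase e).biUnion Sym2.toFinset := by
    intro y _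
    obtain ⟨g, hg, hyg⟩ := hcov y
    simp only [Finset.mem_union, Finset.mem_erase, Finset.mem_biUnion, Sym2.mem_toFinset]
    by_cases hyx : y = x
    · exact Or.inr ⟨f, ⟨hne.symm, hf⟩, hyx ▸ hxf⟩
    · by_cases hge : g = e
      · exact Or.inl ⟨hyx, hge ▸ hyg⟩
      · exact Or.inr ⟨g, ⟨hge, hg⟩, hyg⟩
  have h1 := (Finset.card_le_card hsub).trans (Finset.card_union_le _ _)
  have h2 := card_biUnion_toFinset_le (C.erase e)
  have h3 := Finset.card_erase_of_mem (Sym2.mem_toFinset.2 hxe)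
  have h4 := e.card_toFinset_le_two
  have h5 := Finset.card_pos.2 ⟨e, he⟩
  rw [Finset.card_univ, ZMod.card] at h1
  rw [Finset.card_erase_of_mem he] at h2
  omega

end

/-- For every `m ≥ 1`, every co-blocker of `CGG(2m)` is a perfect matching and
all of its edges have odd order. -/
theorem coBlocker_isPM_and_odd (m : ℕ) (hm : 1 ≤ m)
    (C : Finset (Sym2 (Vtx m))) (hC : IsCoBlocker m C) :
    IsPM m C ∧ ∀ e ∈ C, Odd (edgeOrder m e) := by
  have : NeZero m := ⟨by omega⟩
  have hodd : ∀ x : Vtx m, ∃ e ∈ C.filter (fun e => Odd (edgeOrder m e)), x ∈ e := by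
    intro x
    obtain ⟨e, he⟩ := hC.2.1 _ (isBlocker_oddStar x)
    simp only [oddStar, Finset.mem_inter, Finset.mem_image, Finset.mem_filter, Finset.mem_univ,
      true_and] at he
    obtain ⟨heC, w, hw, rfl⟩ := he
    refine ⟨s(x, w), Finset.mem_filter.2 ⟨heC, ?_⟩, Sym2.mem_mk_left _ _⟩
    exact odd_edgeOrder_of_vtxParity_ne ((ZMod.two_ne_iff_eq_add_one _ _).2 hw).symm
  have hfilter : C.filter (fun e => Odd (edgeOrder m e)) = C :=
    Finset.eq_of_subset_of_card_le (Finset.filter_subset _ _)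
      (hC.card_le.trans (le_card_of_forall_exists_mem hodd))
  rw [hfilter] at hodd
  exact ⟨isPM_of_card_le hC.1 hodd hC.card_le, Finset.filter_eq_self.1 hfilter⟩
end

section
/- Let M be a semi-simple perfect matching of CGG(2m) and let {a,b} and {c,d} be two crossing edges of M. The four vertices a, b, c, d divide the cyclic order into four open arcs; each of these four open arcs contains both endpoints of some boundary edge belonging to M. -/
/-- The truncated subtraction formula for representatives modulo `n`. -/
lemma ZMod.val_sub_eq_ite {n : ℕ} [NeZero n] (u v : ZMod n) :
    (u - v).val = if v.val ≤ u.val then u.val - v.val else u.val + n - v.val := by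
  split_ifs with h
  · exact ZMod.val_sub h
  · have huv : (v - u).val = v.val - u.val := ZMod.val_sub (by omega)
    have hne : v - u ≠ 0 := fun h0 => h (by rw [sub_eq_zero.mp h0])
    have : NeZero (v - u) := ⟨hne⟩
    rw [← neg_sub v u, ZMod.val_neg_of_ne_zero, huv]
    omega

/-- Membership in an arc, read off from the positions relative to a base point `x`. -/
lemma inArc_iff_pos {m : ℕ} [NeZero (2 * m)] (x u v w : Vtx m) :
    InArc m u v w ↔
      ((u - x).val < (w - x).val ∧ (w - x).val < (v - x).val) ∨
      ((w - x).val < (v - x).val ∧ (v - x).val < (u - x).val) ∨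
      ((v - x).val < (u - x).val ∧ (u - x).val < (w - x).val) := by
  have hu := ZMod.val_lt (u - x)
  have hv := ZMod.val_lt (v - x)
  have hw := ZMod.val_lt (w - x)
  unfold InArc
  rw [← sub_sub_sub_cancel_right w u x, ← sub_sub_sub_cancel_right v u x,
    ZMod.val_sub_eq_ite (w - x) (u - x), ZMod.val_sub_eq_ite (v - x) (u - x)]
  split_ifs <;> omega

lemma pos_injective {m : ℕ} [NeZero (2 * m)] (x : Vtx m) {u v : Vtx m}
    (h : (u - x).val = (v - x).val) : u = v :=
  sub_left_injective (ZMod.val_injective _ h)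

lemma pos_add_natCast {m i : ℕ} (x : Vtx m) (hi : i < 2 * m) :
    (x + (i : Vtx m) - x).val = i := by
  rw [add_sub_cancel_left, ZMod.val_cast_of_lt hi]

lemma edgeOrder_add_one {m : ℕ} [NeZero (2 * m)] (u : Vtx m) :
    edgeOrder m s(u, u + 1) = 1 := by
  have hm : 2 * m ≠ 0 := NeZero.ne _
  have : Fact (1 < 2 * m) := ⟨by omega⟩
  have h1 : (u + 1 - u).val = 1 := by rw [add_sub_cancel_left, ZMod.val_one]
  have h0 : (u - (u + 1)).val ≠ 0 := by
    rw [Ne, ZMod.val_eq_zero]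
    simp
  change min (u - (u + 1)).val (u + 1 - u).val = 1
  omega

/-- A finite set of edges cannot cover the integers, so `m ≠ 0`. -/
lemma IsPM.ne_zero {m : ℕ} {M : Finset (Sym2 (Vtx m))} (hM : IsPM m M) : m ≠ 0 := by
  rintro rfl
  have : Infinite (Vtx 0) := inferInstanceAs (Infinite ℤ)
  refine Set.infinite_univ (α := Vtx 0) ?_
  refine (M.finite_toSet.biUnion (t := fun e => {v | v ∈ e}) fun e _ => ?_).subset ?_
  · induction e with
    | _ p q => exact (Set.toFinite {p, q}).subset fun v hv => by simpa using hv
  · intro v _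
    obtain ⟨e, he, hv⟩ := hM.2.2 v
    exact Set.mem_biUnion he hv

lemma IsPM.eq_of_mem {m : ℕ} {M : Finset (Sym2 (Vtx m))} (hM : IsPM m M)
    {e f : Sym2 (Vtx m)} (he : e ∈ M) (hf : f ∈ M) {v : Vtx m} (hve : v ∈ e) (hvf : v ∈ f) :
    e = f := by
  by_contra hne
  exact hM.2.1 e he f hf hne v hve hvf

lemma IsPM.exists_partner {m : ℕ} {M : Finset (Sym2 (Vtx m))} (hM : IsPM m M) (v : Vtx m) :
    ∃ w, s(v, w) ∈ M := by
  obtain ⟨e, he, w, rfl⟩ := hM.2.2 v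
  exact ⟨w, he⟩

lemma IsPM.ne_of_mem {m : ℕ} {M : Finset (Sym2 (Vtx m))} (hM : IsPM m M) {v w : Vtx m}
    (h : s(v, w) ∈ M) : v ≠ w :=
  fun hvw => hM.1 _ h hvw

lemma IsPM.partner_unique {m : ℕ} {M : Finset (Sym2 (Vtx m))} (hM : IsPM m M) {u v w : Vtx m}
    (hv : s(u, v) ∈ M) (hw : s(u, w) ∈ M) : v = w :=
  Sym2.congr_right.mp (hM.eq_of_mem hv hw (Sym2.mem_mk_left u v) (Sym2.mem_mk_left u w))

/-- In a semi-simple matching, if `u + 1` lies on the arc from `u` to its partner, then so does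
the partner of `u + 1`. -/
lemma IsSemiSimple.inArc_succ {m : ℕ} {M : Finset (Sym2 (Vtx m))} (hM : IsSemiSimple m M)
    {u u' v' : Vtx m} (hu : s(u, u') ∈ M) (hv : s(u + 1, v') ∈ M)
    (harc : InArc m u u' (u + 1)) : InArc m u u' v' := by
  by_contra hn
  have hcr : Crosses m s(u, u') s(u + 1, v') := ⟨u, u', u + 1, v', rfl, rfl, Or.inl ⟨harc, hn⟩⟩
  refine hM.2.2 _ hu _ hv (fun heq => ?_)
    ⟨u, Sym2.mem_mk_left _ _, u + 1, Sym2.mem_mk_left _ _, Or.inr rfl⟩ hcr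
  have hmem : u + 1 ∈ s(u, u') := heq ▸ Sym2.mem_mk_left _ _
  rcases Sym2.mem_iff.mp hmem with h | h
  · rw [h] at harc
    simp [InArc] at harc
  · rw [h] at harc
    exact lt_irrefl _ harc.2

/-- If the edges `{x, x'}` and `{y, y'}` of a semi-simple matching appear in the cyclic order
`x, y, x', y'`, then the open arc from `x` to `y` contains a boundary edge of the matching. -/
lemma IsSemiSimple.exists_boundary_edge_inArc {m : ℕ} [NeZero (2 * m)]
    {M : Finset (Sym2 (Vtx m))} (hM : IsSemiSimple m M) {x x' y y' : Vtx m}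
    (hx : s(x, x') ∈ M) (hy : s(y, y') ∈ M)
    (hyx : (y - x).val < (x' - x).val) (hxy : (x' - x).val < (y' - x).val) :
    ∃ f ∈ M, edgeOrder m f = 1 ∧ ∀ v ∈ f, InArc m x y v := by
  by_contra hno
  have hx'lt := ZMod.val_lt (x' - x)
  have key : ∀ i : ℕ, i ≤ (y - x).val → ∀ w : Vtx m, s(x + (i : Vtx m), w) ∈ M →
      i < (w - x).val ∧ (w - x).val ≤ (x' - x).val := by
    intro i
    induction i with
    | zero =>
      intro _ w hw
      rw [Nat.cast_zero, add_zero] at hw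
      obtain rfl := hM.1.partner_unique hx hw
      omega
    | succ i ih =>
      intro hi w hw
      obtain ⟨u', hu'⟩ := hM.1.exists_partner (x + (i : Vtx m))
      obtain ⟨hlt, hle⟩ := ih (by omega) u' hu'
      have hpi : (x + (i : Vtx m) - x).val = i := pos_add_natCast x (by omega)
      have hpi' : (x + ((i + 1 : ℕ) : Vtx m) - x).val = i + 1 := pos_add_natCast x (by omega)
      have hcast : x + ((i + 1 : ℕ) : Vtx m) = x + (i : Vtx m) + 1 := by push_cast; ring
      rw [hcast] at hw hpi'
      have hne : (u' - x).val ≠ i + 1 := by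
        intro heq
        obtain rfl : u' = x + (i : Vtx m) + 1 := pos_injective x (heq.trans hpi'.symm)
        have hi0 : i ≠ 0 := by
          rintro rfl
          rw [Nat.cast_zero, add_zero] at hu'
          rw [Nat.cast_zero, add_zero] at heq
          rw [hM.1.partner_unique hx hu'] at hyx
          omega
        have hiy : i + 1 ≠ (y - x).val := by
          intro h
          obtain rfl := pos_injective x (hpi'.trans h)
          rw [← hM.1.partner_unique (Sym2.eq_swap ▸ hu') hy] at hxy
          omega
        refine hno ⟨_, hu', edgeOrder_add_one _, fun v hv => ?_⟩
        rw [inArc_iff_pos x, sub_self, ZMod.val_zero]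
        rcases Sym2.mem_iff.mp hv with rfl | rfl <;> omega
      have harc := hM.inArc_succ hu' hw (by rw [inArc_iff_pos x]; omega)
      rw [inArc_iff_pos x] at harc
      have hnw : (x + (i : Vtx m) + 1 - x).val ≠ (w - x).val :=
        fun h => hM.1.ne_of_mem hw (pos_injective x h)
      omega
  have hy0 : x + (((y - x).val : ℕ) : Vtx m) = y := by
    rw [ZMod.natCast_zmod_val]; ring
  have := key _ le_rfl y' (by rwa [hy0])
  omega

/-- Crossing edges of a perfect matching have four distinct endpoints. -/
lemma IsPM.disjoint_of_crosses {m : ℕ} {M : Finset (Sym2 (Vtx m))} (hM : IsPM m M)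
    {e f : Sym2 (Vtx m)} (he : e ∈ M) (hf : f ∈ M) (hcr : Crosses m e f) {v : Vtx m}
    (hve : v ∈ e) : v ∉ f := by
  intro hvf
  obtain ⟨a, b, c, d, rfl, rfl, ⟨hx, -⟩ | ⟨hx, -⟩⟩ := hcr <;>
    have h := hM.eq_of_mem he hf hve hvf <;>
    rcases Sym2.eq_iff.mp h with ⟨rfl, rfl⟩ | ⟨rfl, rfl⟩ <;>
    simp [InArc] at hx

/-- For edges with distinct endpoints, crossing does not depend on the order in which the
endpoints are listed. -/
lemma Crosses.inArc_iff_not {m : ℕ} [NeZero (2 * m)] {a b c d : Vtx m}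
    (hcr : Crosses m s(a, b) s(c, d)) (hab : a ≠ b) (hac : a ≠ c) (had : a ≠ d)
    (hbc : b ≠ c) (hbd : b ≠ d) : InArc m a b c ↔ ¬ InArc m a b d := by
  obtain ⟨a', b', c', d', h1, h2, hx⟩ := hcr
  have hne : ∀ {u v : Vtx m}, u ≠ v → (u - 0).val ≠ (v - 0).val :=
    fun huv h => huv (pos_injective 0 h)
  have := hne hab
  have := hne hac
  have := hne had
  have := hne hbc
  have := hne hbd
  replace hx := xor_iff_iff_not.mp hx
  rcases Sym2.eq_iff.mp h1 with ⟨rfl, rfl⟩ | ⟨rfl, rfl⟩ <;>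
    rcases Sym2.eq_iff.mp h2 with ⟨rfl, rfl⟩ | ⟨rfl, rfl⟩ <;>
    simp only [inArc_iff_pos 0] at hx ⊢ <;> omega

/-- If `M` is a semi-simple perfect matching of `CGG(2m)` and `{a,b}`, `{c,d}`
are two crossing edges of `M`, then each of the four open cyclic arcs determined
by the four vertices `a, b, c, d` contains both endpoints of some boundary edge
of `M`. (An arc from `x` to `y`, with `x, y ∈ {a,b,c,d}`, is one of these four
arcs exactly when its interior contains none of `a, b, c, d`.) -/
theorem semiSimple_boundary_edge_in_each_quadrant (m : ℕ)
    (M : Finset (Sym2 (Vtx m))) (hM : IsSemiSimple m M)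
    (a b c d : Vtx m) (h1 : s(a, b) ∈ M) (h2 : s(c, d) ∈ M)
    (hcr : Crosses m s(a, b) s(c, d)) :
    ∀ x ∈ ({a, b, c, d} : Set (Vtx m)), ∀ y ∈ ({a, b, c, d} : Set (Vtx m)),
      x ≠ y → (∀ z ∈ ({a, b, c, d} : Set (Vtx m)), ¬ InArc m x y z) →
      ∃ f ∈ M, edgeOrder m f = 1 ∧ ∀ v ∈ f, InArc m x y v := by
  have : NeZero (2 * m) := ⟨by have := hM.1.ne_zero; omega⟩
  have hab := hM.1.ne_of_mem h1
  have hcd := hM.1.ne_of_mem h2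
  have ha := hM.1.disjoint_of_crosses h1 h2 hcr (Sym2.mem_mk_left a b)
  have hb := hM.1.disjoint_of_crosses h1 h2 hcr (Sym2.mem_mk_right a b)
  rw [Sym2.mem_iff, not_or] at ha hb
  have hx := hcr.inArc_iff_not hab ha.1 ha.2 hb.1 hb.2
  have h1' : s(b, a) ∈ M := Sym2.eq_swap ▸ h1
  have h2' : s(d, c) ∈ M := Sym2.eq_swap ▸ h2
  intro x hxm y hym hxy harc
  have hne : ∀ {u v : Vtx m}, u ≠ v → (u - x).val ≠ (v - x).val :=
    fun huv h => huv (pos_injective x h)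
  have hab := hne hab
  have hcd := hne hcd
  have hac := hne ha.1
  have had := hne ha.2
  have hbc := hne hb.1
  have hbd := hne hb.2
  have hx0 : (x - x).val = 0 := by rw [sub_self, ZMod.val_zero]
  simp only [Set.mem_insert_iff, Set.mem_singleton_iff, forall_eq_or_imp, forall_eq] at harc hxm hym
  rw [inArc_iff_pos x, inArc_iff_pos x] at hx
  simp only [InArc] at harc
  obtain ⟨x', y', hxx, hyy, hlt, hlt'⟩ : ∃ x' y' : Vtx m, s(x, x') ∈ M ∧ s(y, y') ∈ M ∧
      (y - x).val < (x' - x).val ∧ (x' - x).val < (y' - x).val := by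
    rcases hxm with rfl | rfl | rfl | rfl <;> rcases hym with rfl | rfl | rfl | rfl
    all_goals first
      | exact absurd rfl hxy
      | (exfalso; omega)
      | exact ⟨_, _, by assumption, by assumption, by omega, by omega⟩
  exact hM.exists_boundary_edge_inArc hxx hyy hlt hlt'
end

section
/- Let m ≥ 2, let 2 ≤ t ≤ m, and let ε_{t+1}, ε_{t+2}, …, ε_m be integers with 1 ≤ ε_{t+1} < ε_{t+2} < … < ε_m ≤ m−2 (an empty sequence if t = m). Then the set of m edges {{i−1, i} : 1 ≤ i ≤ t} ∪ {{t+j−1−ε_{t+j}, t+j+ε_{t+j}} : 1 ≤ j ≤ m−t}, with all vertex labels taken mod 2m, is a blocker of CGG(2m). -/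
/-- `f` encodes a noncrossing perfect matching of `0, 1, …, n - 1` by its partner function. -/
structure IsNoncrossingInvolution (n : ℕ) (f : ℕ → ℕ) : Prop where
  lt : ∀ x < n, f x < n
  invol : ∀ x < n, f (f x) = x
  ne : ∀ x < n, f x ≠ x
  nested : ∀ x < n, ∀ y, x < y → y < f x → x < f y ∧ f y < f x

namespace IsNoncrossingInvolution

variable {n : ℕ} {f : ℕ → ℕ}

lemma odd_add_of_lt (hf : IsNoncrossingInvolution n f) {x : ℕ} (hx : x < n) (h : x < f x) :
    Odd (x + f x) := by
  have hn := hf.lt x hx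
  have hsum : ∑ _y ∈ Finset.Ioo x (f x), (1 : ZMod 2) = 0 := by
    refine Finset.sum_involution (fun y _ => f y) (fun _ _ => by decide) ?_ ?_ ?_
    · intro y hy _
      rw [Finset.mem_Ioo] at hy
      exact hf.ne y (by omega)
    · intro y hy
      rw [Finset.mem_Ioo] at hy ⊢
      exact hf.nested x hx y hy.1 hy.2
    · intro y hy
      rw [Finset.mem_Ioo] at hy
      exact hf.invol y (by omega)
  rw [Finset.sum_const, Nat.card_Ioo, nsmul_one, ZMod.natCast_eq_zero_iff] at hsum
  rw [Nat.odd_iff]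
  omega

lemma odd_add (hf : IsNoncrossingInvolution n f) {x : ℕ} (hx : x < n) : Odd (x + f x) := by
  rcases lt_or_gt_of_ne (hf.ne x hx) with h | h
  · have := hf.odd_add_of_lt (hf.lt x hx) (by rwa [hf.invol x hx])
    rwa [hf.invol x hx, add_comm] at this
  · exact hf.odd_add_of_lt hx h

/-- If no two consecutive points of `[0, t]` are matched, no two points of `[0, t]` are. -/
lemma apply_ne_of_consecutive (hf : IsNoncrossingInvolution n f) {t : ℕ} (ht : t < n)
    (h : ∀ x < t, f x ≠ x + 1) (d x : ℕ) (hd : x + d + 1 ≤ t) : f x ≠ x + d + 1 := by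
  induction d using Nat.strong_induction_on generalizing x with
  | _ d ih =>
    intro hfx
    rcases Nat.eq_zero_or_pos d with rfl | hpos
    · exact h x (by omega) hfx
    · obtain ⟨h1, h2⟩ := hf.nested x (by omega) (x + 1) (by omega) (by omega)
      have h3 := hf.ne (x + 1) (by omega)
      exact ih (f (x + 1) - x - 2) (by omega) (x + 1) (by omega) (by omega)

lemma lt_apply_of_consecutive (hf : IsNoncrossingInvolution n f) {t : ℕ} (ht : t < n)
    (h : ∀ x < t, f x ≠ x + 1) {x : ℕ} (hx : x ≤ t) : t < f x := by
  by_contra! hle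
  rcases lt_or_gt_of_ne (hf.ne x (by omega)) with hlt | hlt
  · refine hf.apply_ne_of_consecutive ht h (x - f x - 1) (f x) (by omega) ?_
    rw [hf.invol x (by omega)]
    omega
  · exact hf.apply_ne_of_consecutive ht h (f x - x - 1) x (by omega) (by omega)

lemma add_apply_antitone (hf : IsNoncrossingInvolution n f) {t : ℕ} (ht : t < n)
    (h : ∀ x < t, f x ≠ x + 1) {x y : ℕ} (hxy : x ≤ y) (hy : y ≤ t) :
    y + f y ≤ x + f x := by
  induction y, hxy using Nat.le_induction with
  | base => exact le_rfl
  | succ y _ ih =>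
    have h1 := hf.lt_apply_of_consecutive ht h (x := y) (by omega)
    have h2 := (hf.nested y (by omega) (y + 1) (by omega) (by omega)).2
    have := ih (by omega)
    omega

/-- A noncrossing perfect matching of `0, …, 2m - 1` avoiding the path `0, 1, …, t` contains an
edge `{a i, 2i - 1 - a i}` with `t < i ≤ m`, for every antitone `a : (t, m] → [0, t]`. -/
lemma exists_add_eq {m t : ℕ} (hf : IsNoncrossingInvolution (2 * m) f) (htm : t ≤ m) (hm : 0 < m)
    (h : ∀ x < t, f x ≠ x + 1) (a : ℕ → ℕ) (ha : ∀ i, t < i → i ≤ m → a i ≤ t)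
    (hanti : ∀ i, t < i → i < m → a (i + 1) ≤ a i) :
    ∃ i, t < i ∧ i ≤ m ∧ a i + f (a i) + 1 = 2 * i := by
  have ht : t < 2 * m := by omega
  have hlast := hf.lt_apply_of_consecutive ht h le_rfl
  have hzero := hf.lt 0 (by omega)
  have hle := hf.add_apply_antitone ht h (Nat.zero_le t) le_rfl
  by_contra! hne
  have key : ∀ i, t + 1 ≤ i → i ≤ m → 2 * i < a i + f (a i) := by
    intro i hi
    induction i, hi using Nat.le_induction with
    | base =>
      intro him
      have h1 := ha (t + 1) (by omega) him
      have h2 := hf.add_apply_antitone ht h h1 le_rfl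
      have h3 := hne (t + 1) (by omega) him
      obtain ⟨k, hk⟩ := hf.odd_add (x := a (t + 1)) (by omega)
      omega
    | succ i hi ih =>
      intro him
      have h0 := ih (by omega)
      have h1 := ha i (by omega) (by omega)
      have h2 := hanti i (by omega) (by omega)
      have h3 := hf.add_apply_antitone ht h h2 h1
      have h4 := hne (i + 1) (by omega) him
      obtain ⟨k, hk⟩ := hf.odd_add (x := a (i + 1)) (by omega)
      obtain ⟨l, hl⟩ := hf.odd_add (x := a i) (by omega)
      omega
  have h1 := key m (by omega) le_rfl
  have h2 := ha m (by omega) le_rfl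
  have h3 := hf.add_apply_antitone ht h (Nat.zero_le (a m)) h2
  omega

end IsNoncrossingInvolution

lemma inArc_natCast {m x y z : ℕ} (hxz : x ≤ z) (hz : z < 2 * m) (hy : y < 2 * m) :
    InArc m x z y ↔ x < y ∧ y < z := by
  have : NeZero (2 * m) := ⟨by omega⟩
  have val_sub {u v : ℕ} (huv : u ≤ v) (hv : v < 2 * m) :
      ((v : Vtx m) - (u : Vtx m)).val = v - u := by
    rw [← Nat.cast_sub huv, ZMod.val_natCast_of_lt (by omega)]
  unfold InArc
  rw [val_sub hxz hz]
  rcases le_or_gt x y with h | h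
  · rw [val_sub h hy]
    omega
  · have : ((y : Vtx m) - (x : Vtx m)) = ((y + 2 * m - x : ℕ) : Vtx m) := by
      rw [Nat.cast_sub (by omega), Nat.cast_add, ZMod.natCast_self, add_zero]
    rw [this, ZMod.val_natCast_of_lt (by omega)]
    omega

lemma IsSPM.exists_noncrossingInvolution {m : ℕ} {M : Finset (Sym2 (Vtx m))} (hm : 0 < m)
    (hM : IsSPM m M) : ∃ f : ℕ → ℕ, IsNoncrossingInvolution (2 * m) f ∧
      ∀ x : ℕ, s((x : Vtx m), (f x : Vtx m)) ∈ M := by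
  have : NeZero (2 * m) := ⟨by omega⟩
  obtain ⟨⟨hdiag, hdisj, hcov⟩, hcross⟩ := hM
  have hpartner : ∀ x : Vtx m, ∃ y, s(x, y) ∈ M := by
    intro x
    obtain ⟨e, he, y, rfl⟩ := hcov x
    exact ⟨y, he⟩
  choose g hg using hpartner
  have hgf : ∀ x : ℕ, s((x : Vtx m), ((g x).val : Vtx m)) ∈ M := by
    intro x
    rw [ZMod.natCast_rightInverse (g x)]
    exact hg x
  have hgg : ∀ x, g (g x) = x := by
    intro x
    by_contra hne
    refine hdisj _ (hg (g x)) _ (hg x) ?_ (g x) (Sym2.mem_mk_left _ _) (Sym2.mem_mk_right _ _)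
    intro heq
    rw [Sym2.eq_swap, Sym2.congr_left] at heq
    exact hne heq
  have hne : ∀ x, g x ≠ x := fun x hx => hdiag _ (hg x) (by simp [hx])
  have hinvol : ∀ x < 2 * m, (g ((g x).val : Vtx m)).val = x := by
    intro x hx
    rw [ZMod.natCast_rightInverse (g x), hgg, ZMod.val_natCast_of_lt hx]
  have hne' : ∀ x < 2 * m, (g x).val ≠ x := by
    intro x hx heq
    apply hne x
    rw [← ZMod.natCast_rightInverse (g x), heq]
  refine ⟨fun x => (g x).val, ⟨fun x _ => ZMod.val_lt _, hinvol, hne', ?_⟩, hgf⟩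
  intro x hx y hxy hyf
  by_contra hcon
  have hfx := ZMod.val_lt (g x)
  have hfy := ZMod.val_lt (g y)
  refine hcross _ (hgf x) _ (hgf y) ?_ ⟨_, _, _, _, rfl, rfl, ?_⟩
  · intro heq
    have hmem : (y : Vtx m) ∈ s((x : Vtx m), ((g x).val : Vtx m)) := by
      rw [heq]; exact Sym2.mem_mk_left _ _
    have inj {u v : ℕ} (hu : u < 2 * m) (hv : v < 2 * m) (h : (u : Vtx m) = v) : u = v := by
      rw [← ZMod.val_natCast_of_lt hu, h, ZMod.val_natCast_of_lt hv]
    rcases Sym2.mem_iff.1 hmem with h | h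
    · exact hxy.ne' (inj (by omega) hx h)
    · exact hyf.ne (inj (by omega) hfx h)
  · left
    rw [inArc_natCast (by omega) hfx (by omega), inArc_natCast (by omega) hfx hfy]
    exact ⟨⟨hxy, hyf⟩, hcon⟩

lemma ne_of_add_eq_odd {m : ℕ} {a b k : Vtx m} (h : a + b = 2 * k + 1) : a ≠ b := by
  rintro rfl
  have h2 := congrArg (ZMod.castHom (dvd_mul_right 2 m) (ZMod 2)) h
  simp only [map_add, map_mul, map_one, map_ofNat] at h2
  generalize (ZMod.castHom (dvd_mul_right 2 m) (ZMod 2)) a = u at h2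
  generalize (ZMod.castHom (dvd_mul_right 2 m) (ZMod 2)) k = v at h2
  revert u v
  decide

lemma InArc.reflect {m : ℕ} (hm : 0 < m) {a b c d : Vtx m} (h : c + d = a + b)
    (hc : InArc m a b c) : InArc m a b d := by
  have : NeZero (2 * m) := ⟨by omega⟩
  obtain ⟨h1, h2⟩ := hc
  have hd : d - a = (b - a) - (c - a) := by linear_combination h
  unfold InArc
  rw [hd, ZMod.val_sub h2.le]
  omega

/-- The set of all edges of direction `d`. -/
def parallelMatching (m : ℕ) [NeZero (2 * m)] (d : Vtx m) : Finset (Sym2 (Vtx m)) :=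
  Finset.univ.image fun x => s(x, d - x)

lemma edgeDir_of_mem_parallelMatching {m : ℕ} [NeZero (2 * m)] {d : Vtx m} {e : Sym2 (Vtx m)}
    (he : e ∈ parallelMatching m d) : edgeDir m e = d := by
  obtain ⟨x, -, rfl⟩ := Finset.mem_image.1 he
  simp [edgeDir]

lemma isSPM_parallelMatching {m : ℕ} [NeZero (2 * m)] (hm : 0 < m) (k : Vtx m) :
    IsSPM m (parallelMatching m (2 * k + 1)) := by
  refine ⟨⟨?_, ?_, ?_⟩, ?_⟩
  · intro e he
    have h := edgeDir_of_mem_parallelMatching he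
    induction e with | _ a b =>
    exact fun hab => ne_of_add_eq_odd h hab
  · intro e he f hf hef x hxe hxf
    have h1 := edgeDir_of_mem_parallelMatching he
    have h2 := edgeDir_of_mem_parallelMatching hf
    obtain ⟨y, rfl⟩ := hxe
    obtain ⟨z, rfl⟩ := hxf
    apply hef
    have : x + y = x + z := h1.trans h2.symm
    rw [add_left_cancel this]
  · intro x
    exact ⟨_, Finset.mem_image_of_mem _ (Finset.mem_univ x), Sym2.mem_mk_left _ _⟩
  · rintro e he f hf - ⟨a, b, c, d, rfl, rfl, hx⟩
    have h1 : a + b = 2 * k + 1 := edgeDir_of_mem_parallelMatching he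
    have h2 : c + d = 2 * k + 1 := edgeDir_of_mem_parallelMatching hf
    have h3 : c + d = a + b := h2.trans h1.symm
    rcases hx with ⟨h, hn⟩ | ⟨h, hn⟩
    · exact hn (h.reflect hm h3)
    · exact hn (h.reflect hm (by rw [add_comm, h3]))

lemma le_card_of_meets_isSPM {m : ℕ} (hm : 0 < m) {B : Finset (Sym2 (Vtx m))}
    (hB : ∀ M, IsSPM m M → (B ∩ M).Nonempty) : m ≤ B.card := by
  have : NeZero (2 * m) := ⟨by omega⟩
  let dir : ℕ → Vtx m := fun k => 2 * (k : Vtx m) + 1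
  have hinj : Set.InjOn dir (Finset.range m) := by
    intro k hk l hl hkl
    rw [Finset.mem_coe, Finset.mem_range] at hk hl
    have h : ((2 * k + 1 : ℕ) : Vtx m) = ((2 * l + 1 : ℕ) : Vtx m) := by
      push_cast; exact hkl
    have := congrArg ZMod.val h
    rw [ZMod.val_natCast_of_lt (by omega), ZMod.val_natCast_of_lt (by omega)] at this
    omega
  calc m = ((Finset.range m).image dir).card := by
        rw [Finset.card_image_of_injOn hinj, Finset.card_range]
    _ ≤ (B.image (edgeDir m)).card := by
        refine Finset.card_le_card (Finset.image_subset_iff.2 fun k _ => ?_)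
        obtain ⟨e, he⟩ := hB _ (isSPM_parallelMatching hm (k : Vtx m))
        rw [Finset.mem_inter] at he
        exact Finset.mem_image.2 ⟨e, he.1, edgeDir_of_mem_parallelMatching he.2⟩
    _ ≤ B.card := Finset.card_image_le

/-- Let `m ≥ 2`, `2 ≤ t ≤ m`, and let `ε_{t+1} < ε_{t+2} < … < ε_m` be integers
with `1 ≤ ε_{t+1}` and `ε_m ≤ m - 2` (an empty sequence if `t = m`). Then the
set of `m` edges `{{i-1, i} : 1 ≤ i ≤ t} ∪
{{t+j-1-ε_{t+j}, t+j+ε_{t+j}} : 1 ≤ j ≤ m-t}` (labels mod `2m`) is a blocker. -/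
theorem caterpillar_is_blocker (m t : ℕ) (hm : 2 ≤ m) (ht2 : 2 ≤ t)
    (htm : t ≤ m) (ε : ℕ → ℕ)
    (hmono : StrictMonoOn ε (Set.Icc (t + 1) m))
    (hlow : t < m → 1 ≤ ε (t + 1)) (hhigh : t < m → ε m ≤ m - 2) :
    IsBlocker m
      (((Finset.Icc 1 t).image fun i : ℕ =>
          s(((i : Vtx m) - 1), (i : Vtx m))) ∪
        ((Finset.Icc 1 (m - t)).image fun j : ℕ =>
          s(((t : Vtx m) + (j : Vtx m) - 1 - (ε (t + j) : Vtx m)),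
            ((t : Vtx m) + (j : Vtx m) + (ε (t + j) : Vtx m))))) := by
  have hm0 : 0 < m := by omega
  refine ⟨?_, ?_, ?_⟩
  · intro e he
    rcases Finset.mem_union.1 he with he | he
    · obtain ⟨i, -, rfl⟩ := Finset.mem_image.1 he
      rw [Sym2.mk_isDiag_iff]
      exact ne_of_add_eq_odd (k := (i : Vtx m) - 1) (by ring)
    · obtain ⟨j, -, rfl⟩ := Finset.mem_image.1 he
      rw [Sym2.mk_isDiag_iff]
      exact ne_of_add_eq_odd (k := (t : Vtx m) + (j : Vtx m) - 1) (by ring)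
  · intro M hM
    obtain ⟨f, hf, hfM⟩ := IsSPM.exists_noncrossingInvolution hm0 hM
    by_cases hpath : ∃ x < t, f x = x + 1
    · obtain ⟨x, hx, hfx⟩ := hpath
      have hmem := hfM x
      rw [hfx] at hmem
      refine ⟨_, Finset.mem_inter.2 ⟨Finset.mem_union_left _ ?_, hmem⟩⟩
      refine Finset.mem_image.2 ⟨x + 1, Finset.mem_Icc.2 (by omega), ?_⟩
      simp
    · push Not at hpath
      have hstep : ∀ i, t < i → i < m → ε i < ε (i + 1) := fun i hi him =>
        hmono ⟨by omega, by omega⟩ ⟨by omega, by omega⟩ (by omega)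
      have hbound : ∀ k, t + k < m → ε (m - k) + 2 + k ≤ m := by
        intro k
        induction k with
        | zero =>
          intro hk
          have := hhigh hk
          simp only [Nat.sub_zero]
          omega
        | succ k ih =>
          intro hk
          have h1 := ih (by omega)
          have h2 := hstep (m - (k + 1)) (by omega) (by omega)
          rw [show m - (k + 1) + 1 = m - k by omega] at h2
          omega
      have hfirst : ∀ i, t + 1 ≤ i → i ≤ m → i ≤ t + 1 + ε i := by
        intro i hi
        induction i, hi using Nat.le_induction with
        | base => omega
        | succ i hi ih =>
          intro him
          have := ih (by omega)
          have := hstep i (by omega) (by omega)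
          omega
      obtain ⟨i, hti, him, hi⟩ := hf.exists_add_eq htm hm0 hpath (fun i => i - 1 - ε i)
        (fun i hi him => by have := hfirst i hi him; omega)
        (fun i hi him => by have := hstep i hi him; omega)
      have hb := hbound (m - i) (by omega)
      rw [show m - (m - i) = i by omega] at hb
      have hmem := hfM (i - 1 - ε i)
      rw [show f (i - 1 - ε i) = i + ε i by omega] at hmem
      refine ⟨_, Finset.mem_inter.2 ⟨Finset.mem_union_right _ ?_, hmem⟩⟩
      refine Finset.mem_image.2 ⟨i - t, Finset.mem_Icc.2 (by omega), ?_⟩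
      simp only [← Nat.cast_add]
      rw [show t + (i - t) = i by omega, Nat.cast_sub (by omega), Nat.cast_sub (by omega),
        Nat.cast_one]
  · intro B' _ hB'
    refine le_trans ?_ (le_card_of_meets_isSPM hm0 hB')
    refine (Finset.card_union_le _ _).trans ((add_le_add Finset.card_image_le
      Finset.card_image_le).trans ?_)
    rw [Nat.card_Icc, Nat.card_Icc]
    omega
end
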